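/- Fix s₀ > 0 and for an integer k ≥ 1 set t_k = s₀(2^{2k} − 1). Let f : ℝ² → ℂ be integrable, let w_{−1}, w_0, w_1 : ℝ² → ℂ be integrable convolution kernels, and define the Gaussian pyramid p_n(x) = (G(·, t_n) ⋆ f)(2ⁿ x) for integers n ≥ 1 and the pyramid convolution output y_l(z) = Σ_{k=−1}^{1} (w_k ⋆ p_{l+k})(2^{−k} z) for integers l ≥ 2. Then pyramid convolution commutes with the jumping action on the Gaussian pyramid: for all integers l ≥ 2, m ≥ 1 and every z ∈ ℝ², y_{l+m}(z) = Σ_{k=−1}^{1} (w_k ⋆ S_m[p_{l+k}])(2^{−k} z), where (S_m[q])(x) = (G(·, t_m) ⋆ q)(2^m x). In particular, the pyramid-convolution output at level l+m is obtained by applying the pyramid convolution to the S_m-shifted pyramid (scale equivariance of pyramid convolution on a Gaussian pyramid). -/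

import Mathlib

open MeasureTheory

/-- The 2-D Gauss–Weierstrass kernel `G(x, t) = (4πt)⁻¹ exp(−‖x‖²/(4t))`. -/
noncomputable def gaussKernel (x : EuclideanSpace ℝ (Fin 2)) (t : ℝ) : ℝ :=
  (4 * Real.pi * t)⁻¹ * Real.exp (-‖x‖ ^ 2 / (4 * t))

/-- Convolution `(g ⋆ f)(x) = ∫ g(y) f(x − y) dy` on `ℝ²`. -/
noncomputable def conv (g f : EuclideanSpace ℝ (Fin 2) → ℂ)
    (x : EuclideanSpace ℝ (Fin 2)) : ℂ :=
  ∫ y, g y * f (x - y)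

/-- `t_k = s₀ (2^{2k} − 1)` (for integer `k`). -/
noncomputable def tvar (s₀ : ℝ) (k : ℤ) : ℝ := s₀ * ((2 : ℝ) ^ (2 * k) - 1)

/-- Gaussian pyramid level `n`: `p_n(x) = (G(·, t_n) ⋆ f)(2ⁿ x)`. -/
noncomputable def pyramid (s₀ : ℝ) (f : EuclideanSpace ℝ (Fin 2) → ℂ) (n : ℤ)
    (x : EuclideanSpace ℝ (Fin 2)) : ℂ :=
  conv (fun y => (gaussKernel y (tvar s₀ n) : ℂ)) f (((2 : ℝ) ^ n) • x)

/-- The jumping action `(S_m[q])(x) = (G(·, t_m) ⋆ q)(2^m x)`. -/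
noncomputable def jump (s₀ : ℝ) (m : ℤ) (q : EuclideanSpace ℝ (Fin 2) → ℂ)
    (x : EuclideanSpace ℝ (Fin 2)) : ℂ :=
  conv (fun y => (gaussKernel y (tvar s₀ m) : ℂ)) q (((2 : ℝ) ^ m) • x)

/-- Pyramid convolution output `y_l(z) = Σ_{k=−1}^{1} (w_k ⋆ p_{l+k})(2^{−k} z)`. -/
noncomputable def pconvOut (s₀ : ℝ) (f : EuclideanSpace ℝ (Fin 2) → ℂ)
    (w : ℤ → EuclideanSpace ℝ (Fin 2) → ℂ) (l : ℤ)
    (z : EuclideanSpace ℝ (Fin 2)) : ℂ :=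
  ∑ k ∈ Finset.Icc (-1 : ℤ) 1, conv (w k) (pyramid s₀ f (l + k)) (((2 : ℝ) ^ (-k)) • z)

lemma gaussKernel_smul (x : EuclideanSpace ℝ (Fin 2)) (t : ℝ) {c : ℝ} (hc : c ≠ 0) :
    gaussKernel (c • x) (c ^ 2 * t) = (c ^ 2)⁻¹ * gaussKernel x t := by
  have hexp : -‖c • x‖ ^ 2 / (4 * (c ^ 2 * t)) = -‖x‖ ^ 2 / (4 * t) := by
    rw [norm_smul, mul_pow, Real.norm_eq_abs, sq_abs,
      show -(c ^ 2 * ‖x‖ ^ 2) = c ^ 2 * -‖x‖ ^ 2 by ring,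
      show 4 * (c ^ 2 * t) = c ^ 2 * (4 * t) by ring,
      mul_div_mul_left _ _ (pow_ne_zero 2 hc)]
  rw [gaussKernel, gaussKernel, hexp, show 4 * Real.pi * (c ^ 2 * t) = c ^ 2 * (4 * Real.pi * t) by
    ring, mul_inv, mul_assoc]

lemma continuous_gaussKernel (t : ℝ) : Continuous fun x => gaussKernel x t := by
  unfold gaussKernel
  fun_prop

lemma integrable_exp_neg_mul_sq_norm {b : ℝ} (hb : 0 < b) :
    Integrable fun x : EuclideanSpace ℝ (Fin 2) => Real.exp (-b * ‖x‖ ^ 2) := by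
  by_contra h
  have hint := GaussianFourier.integral_rexp_neg_mul_sq_norm
    (V := EuclideanSpace ℝ (Fin 2)) hb
  rw [integral_undef h] at hint
  have : 0 < (Real.pi / b) ^ ((Module.finrank ℝ (EuclideanSpace ℝ (Fin 2)) : ℝ) / 2) := by
    positivity
  exact this.ne hint

lemma integrable_gaussKernel {t : ℝ} (ht : 0 < t) : Integrable fun x => gaussKernel x t := by
  refine ((integrable_exp_neg_mul_sq_norm (b := (4 * t)⁻¹) (by positivity)).const_mul
    (4 * Real.pi * t)⁻¹).congr (.of_forall fun x => ?_)
  simp only [gaussKernel]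
  congr 2
  ring

lemma norm_gaussKernel_le {t : ℝ} (ht : 0 < t) (x : EuclideanSpace ℝ (Fin 2)) :
    ‖gaussKernel x t‖ ≤ (4 * Real.pi * t)⁻¹ := by
  have hle : Real.exp (-‖x‖ ^ 2 / (4 * t)) ≤ 1 := by
    rw [Real.exp_le_one_iff, neg_div]
    exact neg_nonpos.2 (by positivity)
  rw [gaussKernel, Real.norm_of_nonneg (by positivity)]
  exact mul_le_of_le_one_right (by positivity) hle

/-- Completing the square in the product of two heat kernels. -/
lemma gaussKernel_mul_gaussKernel {a b : ℝ} (ha : 0 < a) (hb : 0 < b)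
    (y v : EuclideanSpace ℝ (Fin 2)) :
    gaussKernel y a * gaussKernel (v - y) b =
      gaussKernel v (a + b) * gaussKernel (y - (a / (a + b)) • v) (a * b / (a + b)) := by
  have hab : a + b ≠ 0 := by positivity
  simp only [gaussKernel]
  rw [mul_mul_mul_comm, mul_mul_mul_comm (4 * Real.pi * (a + b))⁻¹, ← Real.exp_add, ← Real.exp_add]
  congr 1
  · field_simp
  · congr 1
    rw [norm_sub_sq_real, norm_sub_sq_real, norm_smul, mul_pow, Real.norm_eq_abs, sq_abs,
      inner_smul_right, real_inner_comm v y]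
    field_simp
    ring

lemma integral_gaussKernel {t : ℝ} (ht : 0 < t) : ∫ x, gaussKernel x t = 1 := by
  have hint := GaussianFourier.integral_rexp_neg_mul_sq_norm
    (V := EuclideanSpace ℝ (Fin 2)) (b := (4 * t)⁻¹) (by positivity)
  simp only [finrank_euclideanSpace, Fintype.card_fin, Nat.cast_ofNat, div_self_of_invertible,
    Real.rpow_one] at hint
  have hfun : (fun x => gaussKernel x t) =
      fun x => (4 * Real.pi * t)⁻¹ * Real.exp (-(4 * t)⁻¹ * ‖x‖ ^ 2) := by
    funext x
    simp only [gaussKernel]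
    congr 2
    ring
  rw [hfun, integral_const_mul, hint]
  have := Real.pi_ne_zero
  field_simp

lemma integral_gaussKernel_mul_gaussKernel {a b : ℝ} (ha : 0 < a) (hb : 0 < b)
    (v : EuclideanSpace ℝ (Fin 2)) :
    ∫ y, gaussKernel y a * gaussKernel (v - y) b = gaussKernel v (a + b) := by
  simp_rw [gaussKernel_mul_gaussKernel ha hb]
  rw [integral_const_mul, integral_sub_right_eq_self (fun y => gaussKernel y (a * b / (a + b))),
    integral_gaussKernel (by positivity), mul_one]

/-- The semigroup property of the heat kernel, acting on integrable functions. -/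
lemma conv_gaussKernel_conv_gaussKernel {a b : ℝ} (ha : 0 < a) (hb : 0 < b)
    {f : EuclideanSpace ℝ (Fin 2) → ℂ} (hf : Integrable f) (x : EuclideanSpace ℝ (Fin 2)) :
    conv (fun y => (gaussKernel y a : ℂ)) (conv (fun y => (gaussKernel y b : ℂ)) f) x =
      conv (fun y => (gaussKernel y (a + b) : ℂ)) f x := by
  have hshift (y : EuclideanSpace ℝ (Fin 2)) :
      (gaussKernel y a : ℂ) * ∫ u, (gaussKernel u b : ℂ) * f (x - y - u) =
        ∫ v, (gaussKernel (v - y) b : ℂ) * ((gaussKernel y a : ℂ) * f (x - v)) := by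
    rw [← integral_const_mul, ← integral_sub_right_eq_self _ y]
    refine integral_congr_ae (.of_forall fun v => ?_)
    simp only [sub_sub, add_sub_cancel]
    ring
  have hprod : Integrable (fun p : EuclideanSpace ℝ (Fin 2) × EuclideanSpace ℝ (Fin 2) =>
      (gaussKernel (p.2 - p.1) b : ℂ) * ((gaussKernel p.1 a : ℂ) * f (x - p.2)))
      (volume.prod volume) := by
    refine ((integrable_gaussKernel ha).ofReal.mul_prod (hf.comp_sub_left x)).bdd_mul
      (c := (4 * Real.pi * b)⁻¹) ?_ (.of_forall fun p => ?_)
    · exact (Complex.continuous_ofReal.comp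
        ((continuous_gaussKernel b).comp (by fun_prop))).aestronglyMeasurable
    · rw [Complex.norm_real]
      exact norm_gaussKernel_le hb _
  unfold conv
  simp_rw [hshift]
  rw [integral_integral_swap hprod]
  refine integral_congr_ae (.of_forall fun v => ?_)
  simp only
  rw [← integral_gaussKernel_mul_gaussKernel ha hb, ← integral_complex_ofReal,
    ← integral_mul_const]
  refine integral_congr_ae (.of_forall fun y => ?_)
  push_cast
  ring

lemma conv_gaussKernel_comp_smul (t : ℝ) {c : ℝ} (hc : c ≠ 0)
    (g : EuclideanSpace ℝ (Fin 2) → ℂ) (x : EuclideanSpace ℝ (Fin 2)) :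
    conv (fun y => (gaussKernel y t : ℂ)) (fun y => g (c • y)) x =
      conv (fun y => (gaussKernel y (c ^ 2 * t) : ℂ)) g (c • x) := by
  have hscale := Measure.integral_comp_smul (volume : Measure (EuclideanSpace ℝ (Fin 2)))
    (fun y => (gaussKernel y (c ^ 2 * t) : ℂ) * g (c • x - y)) c
  simp only [gaussKernel_smul _ _ hc, ← smul_sub, finrank_euclideanSpace, Fintype.card_fin,
    abs_of_nonneg (inv_nonneg.2 (sq_nonneg c)), Complex.ofReal_mul, mul_assoc,
    integral_const_mul, Complex.real_smul] at hscale
  exact mul_left_cancel₀ (by simpa using hc) hscale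

lemma tvar_pos {s₀ : ℝ} (hs₀ : 0 < s₀) {k : ℤ} (hk : 1 ≤ k) : 0 < tvar s₀ k :=
  mul_pos hs₀ (sub_pos.2 (one_lt_zpow₀ one_lt_two (by lia)))

lemma tvar_add (s₀ : ℝ) (n m : ℤ) :
    tvar s₀ (n + m) = ((2 : ℝ) ^ n) ^ 2 * tvar s₀ m + tvar s₀ n := by
  simp only [tvar, zpow_add₀ (two_ne_zero' ℝ), two_mul]
  ring

lemma jump_pyramid {s₀ : ℝ} (hs₀ : 0 < s₀) {f : EuclideanSpace ℝ (Fin 2) → ℂ}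
    (hf : Integrable f) {n m : ℤ} (hn : 1 ≤ n) (hm : 1 ≤ m) :
    jump s₀ m (pyramid s₀ f n) = pyramid s₀ f (n + m) := by
  funext x
  have h2 : (2 : ℝ) ^ n ≠ 0 := by positivity
  have ht := tvar_pos hs₀ hm
  unfold jump pyramid
  rw [conv_gaussKernel_comp_smul _ h2, conv_gaussKernel_conv_gaussKernel (by positivity)
    (tvar_pos hs₀ hn) hf, smul_smul, ← zpow_add₀ two_ne_zero, tvar_add]

theorem pconv_scale_equivariance (s₀ : ℝ) (hs₀ : 0 < s₀)
    (f : EuclideanSpace ℝ (Fin 2) → ℂ) (hf : Integrable f)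
    (w : ℤ → EuclideanSpace ℝ (Fin 2) → ℂ)
    (hw : ∀ k ∈ Finset.Icc (-1 : ℤ) 1, Integrable (w k))
    (l m : ℤ) (hl : 2 ≤ l) (hm : 1 ≤ m) (z : EuclideanSpace ℝ (Fin 2)) :
    pconvOut s₀ f w (l + m) z
      = ∑ k ∈ Finset.Icc (-1 : ℤ) 1,
          conv (w k) (jump s₀ m (pyramid s₀ f (l + k))) (((2 : ℝ) ^ (-k)) • z) := by
  unfold pconvOut
  refine Finset.sum_congr rfl fun k hk => ?_
  rw [jump_pyramid hs₀ hf (by have := Finset.mem_Icc.1 hk; lia) hm, add_right_comm]
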